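/- arXiv:2406.04757 — 2 statements merged into one kernel-verified Lean document; each statement's English description precedes it below -/
import Mathlib

section
/- Assume 1 ≤ k ≤ n(q-1). Then the dimension of the projective Reed-Muller code C_{n,k}^q equals C(n+k, k) − Σ_{j=2}^{n+1} (-1)^j · C(n+1, j) · Σ_{i=0}^{j-2} C(k + (i+1)(q-1) - jq + n, k + (i+1)(q-1) - jq). -/
open scoped BigOperators

/-- A vector in `F^(n+1)` is a standard representative if its leftmost nonzero
coordinate equals `1`. -/
def IsStdRep {F : Type*} [Field F] {n : ℕ} (v : Fin (n + 1) → F) : Prop :=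
  ∃ i, (∀ j, j < i → v j = 0) ∧ v i = 1

/-- The set of standard affine representatives of the points of projective n-space. -/
abbrev ProjPts (F : Type*) [Field F] (n : ℕ) : Type _ :=
  {v : Fin (n + 1) → F // IsStdRep v}

noncomputable instance {F : Type*} [Field F] [Fintype F] {n : ℕ} :
    Fintype (ProjPts F n) := Fintype.ofFinite _

/-- Evaluation of a polynomial at the standard representatives, as a linear map. -/
noncomputable def evalOnPts (F : Type*) [Field F] [Fintype F] (n : ℕ) :
    MvPolynomial (Fin (n + 1)) F →ₗ[F] (ProjPts F n → F) where
  toFun f := fun p => MvPolynomial.eval p.1 f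
  map_add' f g := by ext p; simp
  map_smul' c f := by ext p; simp [MvPolynomial.smul_eval]

/-- The projective Reed–Muller code `C_{n,k}^q`: evaluations of homogeneous degree-`k`
polynomials at the standard representatives of the points of `ℙ^n(F)`. -/
noncomputable def PRM (F : Type*) [Field F] [Fintype F] (n k : ℕ) :
    Submodule F (ProjPts F n → F) :=
  Submodule.map (evalOnPts F n) (MvPolynomial.homogeneousSubmodule (Fin (n + 1)) F k)

/-- The dual code with respect to the standard bilinear form. -/
noncomputable def dualCode {F : Type*} [Field F] [Fintype F] {n : ℕ}
    (C : Submodule F (ProjPts F n → F)) : Submodule F (ProjPts F n → F) where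
  carrier := {y | ∀ c ∈ C, ∑ p : ProjPts F n, y p * c p = 0}
  zero_mem' := by intro c hc; simp
  add_mem' := by
    intro a b ha hb c hc
    show ∑ p : ProjPts F n, (a + b) p * c p = 0
    simp only [Pi.add_apply, add_mul, Finset.sum_add_distrib, ha c hc, hb c hc, add_zero]
  smul_mem' := by
    intro r a ha c hc
    show ∑ p : ProjPts F n, (r • a) p * c p = 0
    simp only [Pi.smul_apply, smul_eq_mul, mul_assoc, ← Finset.mul_sum, ha c hc, mul_zero]

/-- Binomial coefficient `C(a,b)` for integers, taken to be `0` when `b < 0`. -/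
def intBinom (a b : ℤ) : ℤ := if 0 ≤ b then (a.toNat.choose b.toNat : ℤ) else 0


section PowerSeries

open PowerSeries Finset

/-- Generating-function identity obtained by summing the geometric series in `u = (1 - X^q)/(1 - X)`
on one side and the binomial series on the other. -/
theorem PowerSeries.sum_geom_pow_eq (r n : ℕ) (hr : r ≠ 0) :
    1 + ∑ m ∈ range (n + 1), (X * mk 1) * (∑ i ∈ range (r + 1), (X : ℤ⟦X⟧) ^ i) ^ m =
      mk 1 ^ (n + 1) - ∑ j ∈ Icc 2 (n + 1), ((-1) ^ j * ((n + 1).choose j : ℤ⟦X⟧)) *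
        ∑ i ∈ range (j - 1), mk 1 ^ (n + 1) * X ^ (j + (j - 1 - i) * r) := by
  set U : ℤ⟦X⟧ := mk 1 with hU
  set G : ℤ⟦X⟧ := ∑ i ∈ range (r + 1), X ^ i with hG
  set w : ℤ⟦X⟧ := X ^ r with hw
  have hU1 : U * (1 - X) = 1 := mk_one_mul_one_sub_eq_one ℤ
  have hG1 : G * (1 - X) = 1 - X * w := by
    rw [hG, geom_sum_mul_neg, pow_succ']
  have hGU : G = U * (1 - X * w) := by
    linear_combination U * hG1 - G * hU1
  have hw1 : (1 : ℤ⟦X⟧) - w ≠ 0 := by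
    intro h
    have := congrArg (coeff (R := ℤ) 0) h
    simp [hw, hr] at this
  have inner (j : ℕ) (hj : 2 ≤ j) :
      (1 - w) * ∑ i ∈ range (j - 1), U ^ (n + 1) * X ^ (j + (j - 1 - i) * r) =
        U ^ (n + 1) * (X ^ j * (w - w ^ j)) := by
    have h1 : ∑ i ∈ range (j - 1), U ^ (n + 1) * X ^ (j + (j - 1 - i) * r) =
        U ^ (n + 1) * X ^ j * w * ∑ i ∈ range (j - 1), w ^ i := by
      rw [mul_sum, ← sum_range_reflect]
      refine sum_congr rfl fun i hi => ?_
      rw [mem_range] at hi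
      have : j - 1 - (j - 1 - 1 - i) = i + 1 := by omega
      rw [this, hw]
      ring
    obtain ⟨l, rfl⟩ : ∃ l, j = l + 1 := ⟨j - 1, by omega⟩
    rw [h1, mul_left_comm, mul_neg_geom_sum, Nat.add_sub_cancel]
    ring
  have binom : ∑ j ∈ Icc 2 (n + 1), ((-1) ^ j * ((n + 1).choose j : ℤ⟦X⟧)) * (X ^ j * (w - w ^ j)) =
      w * (1 - X) ^ (n + 1) - (1 - X * w) ^ (n + 1) - (w - 1) := by
    have e1 : (1 - X : ℤ⟦X⟧) ^ (n + 1) =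
        ∑ j ∈ range (n + 2), (-1) ^ j * ((n + 1).choose j : ℤ⟦X⟧) * X ^ j := by
      rw [sub_eq_neg_add, add_pow]
      refine sum_congr rfl fun j _ => ?_
      rw [neg_pow]; ring
    have e2 : (1 - X * w : ℤ⟦X⟧) ^ (n + 1) =
        ∑ j ∈ range (n + 2), (-1) ^ j * ((n + 1).choose j : ℤ⟦X⟧) * (X ^ j * w ^ j) := by
      rw [sub_eq_neg_add, add_pow]
      refine sum_congr rfl fun j _ => ?_
      rw [neg_pow, mul_pow]; ring
    have e3 : range (n + 2) = insert 0 (insert 1 (Icc 2 (n + 1))) := by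
      ext j; simp only [mem_range, mem_insert, mem_Icc]; omega
    have e4 : w * (1 - X) ^ (n + 1) - (1 - X * w) ^ (n + 1) = ∑ j ∈ range (n + 2),
        ((-1) ^ j * ((n + 1).choose j : ℤ⟦X⟧)) * (X ^ j * (w - w ^ j)) := by
      rw [e1, e2, mul_sum, ← sum_sub_distrib]
      refine sum_congr rfl fun j _ => ?_
      ring
    rw [e4, e3, sum_insert (by simp), sum_insert (by simp)]
    simp
  apply mul_left_cancel₀ hw1
  rw [mul_add, mul_sub, ← mul_sum, mul_sum (Icc 2 (n + 1))]
  have h2 : ∀ j ∈ Icc 2 (n + 1), (1 - w) * (((-1) ^ j * ((n + 1).choose j : ℤ⟦X⟧)) *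
      ∑ i ∈ range (j - 1), U ^ (n + 1) * X ^ (j + (j - 1 - i) * r)) =
      U ^ (n + 1) * (((-1) ^ j * ((n + 1).choose j : ℤ⟦X⟧)) * (X ^ j * (w - w ^ j))) := by
    intro j hj
    rw [mul_left_comm, inner j (mem_Icc.mp hj).1]
    ring
  rw [sum_congr rfl h2, ← mul_sum, binom]
  have h3 := mul_geom_sum G (n + 1)
  have h4 : (1 - w) * (X * U) = G - 1 := by
    linear_combination (-1 : ℤ⟦X⟧) * hGU - hU1
  have h5 : G ^ (n + 1) = U ^ (n + 1) * (1 - X * w) ^ (n + 1) := by rw [← mul_pow, ← hGU]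
  have h6 : U ^ (n + 1) * (1 - X) ^ (n + 1) = 1 := by rw [← mul_pow, hU1, one_pow]
  rw [← mul_assoc, h4, h3]
  linear_combination h5 + w * h6

theorem PowerSeries.coeff_mk_one_pow_mul_X_pow (n k e : ℕ) (d : ℤ) (hd : d = k - e) :
    coeff k ((mk 1 : ℤ⟦X⟧) ^ (n + 1) * X ^ e) = intBinom (d + n) d := by
  rw [coeff_mul_X_pow', mk_one_pow_eq_mk_choose_add, intBinom]
  by_cases h : e ≤ k
  · obtain ⟨c, rfl⟩ := Nat.exists_eq_add_of_le h
    have : d = c := by push_cast at hd; omega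
    subst this
    have h2 : ((c : ℤ) + n).toNat = c + n := by omega
    simp [h2, add_comm n c, Nat.choose_symm_add]
  · rw [if_neg h, if_neg (by omega)]

end PowerSeries

section Exponents

open Finset

/-- The exponent vectors of degree `k` whose first nonzero entry has index `i` and whose later
entries are smaller than `q`. -/
def reducedExpsAt (q n k : ℕ) (i : Fin (n + 1)) : Finset (Fin (n + 1) →₀ ℕ) :=
  (finsuppAntidiag univ k).filter fun a => (∀ j < i, a j = 0) ∧ a i ≠ 0 ∧ ∀ j > i, a j < q

theorem mem_reducedExpsAt {q n k : ℕ} {i : Fin (n + 1)} {a : Fin (n + 1) →₀ ℕ} :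
    a ∈ reducedExpsAt q n k i ↔
      ∑ j, a j = k ∧ (∀ j < i, a j = 0) ∧ a i ≠ 0 ∧ ∀ j > i, a j < q := by
  simp [reducedExpsAt]

/-- The exponent vectors of degree `k` that represent monomial functions on projective space. -/
def reducedExps (q n k : ℕ) : Finset (Fin (n + 1) →₀ ℕ) :=
  univ.biUnion (reducedExpsAt q n k)

theorem mem_reducedExps {q n k : ℕ} {a : Fin (n + 1) →₀ ℕ} :
    a ∈ reducedExps q n k ↔
      ∃ i, ∑ j, a j = k ∧ (∀ j < i, a j = 0) ∧ a i ≠ 0 ∧ ∀ j > i, a j < q := by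
  simp [reducedExps, mem_reducedExpsAt]

theorem first_ne_zero_unique {ι M : Type*} [LinearOrder ι] [Zero M] {a : ι → M} {i i' : ι}
    (h : ∀ j < i, a j = 0) (hi : a i ≠ 0) (h' : ∀ j < i', a j = 0) (hi' : a i' ≠ 0) : i = i' :=
  le_antisymm (not_lt.mp fun hlt => hi' (h _ hlt)) (not_lt.mp fun hlt => hi (h' _ hlt))

theorem card_reducedExpsAt (q n k : ℕ) (i : Fin (n + 1)) :
    ((reducedExpsAt q n k i).card : ℤ) = PowerSeries.coeff k ((PowerSeries.X * PowerSeries.mk 1) *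
      (∑ l ∈ range q, (PowerSeries.X : PowerSeries ℤ) ^ l) ^ (n - i : ℕ)) := by
  have hprod : (PowerSeries.X * PowerSeries.mk 1) *
      (∑ l ∈ range q, (PowerSeries.X : PowerSeries ℤ) ^ l) ^ (n - i : ℕ) =
      ∏ j, if j < i then 1 else if j = i then PowerSeries.X * PowerSeries.mk 1
        else ∑ l ∈ range q, (PowerSeries.X : PowerSeries ℤ) ^ l := by
    rw [prod_ite, prod_const_one, one_mul, prod_ite, prod_const, prod_const]
    congr 2
    · have : (univ.filter fun j => ¬ j < i).filter (fun j => j = i) = {i} := by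
        ext j; simp +contextual
      rw [this, card_singleton, pow_one]
    · have : (univ.filter fun j => ¬ j < i).filter (fun j => ¬ j = i) = Ioi i := by
        ext j; simp only [mem_filter, mem_univ, true_and, mem_Ioi]; omega
      rw [this, Fin.card_Ioi]
      omega
  rw [hprod, PowerSeries.coeff_prod, reducedExpsAt, card_filter, Nat.cast_sum]
  refine sum_congr rfl fun a _ => ?_
  have hcoeff (j : Fin (n + 1)) : PowerSeries.coeff (a j)
      (if j < i then 1 else if j = i then PowerSeries.X * PowerSeries.mk 1
        else ∑ l ∈ range q, (PowerSeries.X : PowerSeries ℤ) ^ l) =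
      if (j < i → a j = 0) ∧ (j = i → a j ≠ 0) ∧ (j > i → a j < q) then 1 else 0 := by
    rcases lt_trichotomy j i with h | h | h
    · simp [h, h.ne, h.not_gt, PowerSeries.coeff_one]
    · subst h
      rcases hj : a j with _ | m <;> simp [PowerSeries.coeff_succ_X_mul]
    · simp [h, h.ne', h.not_gt, PowerSeries.coeff_X_pow]
  rw [prod_congr rfl fun j _ => hcoeff j, prod_boole]
  push_cast
  congr 1
  simp only [mem_univ, true_implies, forall_and, forall_eq]

theorem card_reducedExps (q n k : ℕ) :
    ((reducedExps q n k).card : ℤ) = ∑ m ∈ range (n + 1), PowerSeries.coeff k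
      ((PowerSeries.X * PowerSeries.mk 1) *
        (∑ l ∈ range q, (PowerSeries.X : PowerSeries ℤ) ^ l) ^ m) := by
  rw [reducedExps, card_biUnion, Nat.cast_sum, sum_congr rfl fun i _ => card_reducedExpsAt q n k i]
  · set f : ℕ → ℤ := fun m => PowerSeries.coeff k ((PowerSeries.X * PowerSeries.mk 1) *
      (∑ l ∈ range q, (PowerSeries.X : PowerSeries ℤ) ^ l) ^ m)
    exact (Fin.sum_univ_eq_sum_range (fun m => f (n - m)) (n + 1)).trans
      (sum_range_reflect f (n + 1))
  · intro i _ i' _ hne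
    refine disjoint_left.mpr fun a ha ha' => hne ?_
    rw [mem_reducedExpsAt] at ha ha'
    exact first_ne_zero_unique ha.2.1 ha.2.2.1 ha'.2.1 ha'.2.2.1

/-- The reduction of an exponent modulo the relation `x ^ q = x`. -/
def reduceExp (q a : ℕ) : ℕ := if a = 0 then 0 else (a - 1) % (q - 1) + 1

theorem reduceExp_zero (q : ℕ) : reduceExp q 0 = 0 := rfl

theorem reduceExp_eq_zero {q a : ℕ} : reduceExp q a = 0 ↔ a = 0 := by
  unfold reduceExp; split_ifs with h <;> simp [h]

theorem reduceExp_lt {q : ℕ} (hq : 2 ≤ q) (a : ℕ) : reduceExp q a < q := by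
  unfold reduceExp
  split_ifs
  · omega
  · have := Nat.mod_lt (a - 1) (show 0 < q - 1 by omega); omega

theorem reduceExp_of_lt {q a : ℕ} (h : a < q) : reduceExp q a = a := by
  unfold reduceExp
  split_ifs with h0
  · exact h0.symm
  · rw [Nat.mod_eq_of_lt (by omega)]; omega

theorem exists_eq_reduceExp_add (q a : ℕ) : ∃ c, a = reduceExp q a + (q - 1) * c := by
  unfold reduceExp
  split_ifs with h
  · exact ⟨0, by simp [h]⟩
  · exact ⟨(a - 1) / (q - 1), by have := Nat.mod_add_div (a - 1) (q - 1); omega⟩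

theorem injOn_mapRange_reduceExp (q n k : ℕ) :
    Set.InjOn (Finsupp.mapRange (reduceExp q) (reduceExp_zero q))
      (reducedExps q n k : Set (Fin (n + 1) →₀ ℕ)) := by
  intro a ha b hb hab
  simp only [mem_coe, mem_reducedExps] at ha hb
  obtain ⟨i, hak, ha0, hai, haq⟩ := ha
  obtain ⟨i', hbk, hb0, hbi, hbq⟩ := hb
  have hab' (j) : reduceExp q (a j) = reduceExp q (b j) := by
    simpa using DFunLike.congr_fun hab j
  have hz (j) : a j = 0 ↔ b j = 0 := by
    rw [← reduceExp_eq_zero (q := q), hab', reduceExp_eq_zero]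
  obtain rfl : i = i' := first_ne_zero_unique (a := a) ha0 hai
    (fun j hj => (hz j).2 (hb0 j hj)) (fun h => hbi ((hz _).1 h))
  have hne (j) (hj : j ≠ i) : a j = b j := by
    rcases lt_or_gt_of_ne hj with h | h
    · rw [ha0 j h, hb0 j h]
    · simpa [reduceExp_of_lt (haq j h), reduceExp_of_lt (hbq j h)] using hab' j
  ext j
  by_cases hj : j = i
  · subst hj
    rw [← add_sum_erase _ _ (mem_univ j)] at hak hbk
    have hs : ∑ l ∈ univ.erase j, a l = ∑ l ∈ univ.erase j, b l :=
      sum_congr rfl fun l hl => hne l (ne_of_mem_erase hl)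
    omega
  · exact hne j hj

end Exponents

section Evaluation

open Finset MvPolynomial

theorem eval_monomial_one {R : Type*} [CommSemiring R] {n : ℕ} (v : Fin (n + 1) → R)
    (a : Fin (n + 1) →₀ ℕ) :
    eval v (monomial a 1) = ∏ j, v j ^ a j := by
  rw [eval_monomial, one_mul, Finsupp.prod_fintype _ _ fun _ => pow_zero _]

variable {F : Type*} [Field F] [Fintype F]

theorem pow_add_card_sub_one_mul (x : F) {m : ℕ} (hm : m ≠ 0) (c : ℕ) :
    x ^ (m + (Fintype.card F - 1) * c) = x ^ m := by
  by_cases hx : x = 0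
  · rw [hx, zero_pow hm, zero_pow (by omega)]
  · rw [pow_add, pow_mul, FiniteField.pow_card_sub_one_eq_one x hx, one_pow, mul_one]

theorem pow_reduceExp (x : F) (a : ℕ) : x ^ reduceExp (Fintype.card F) a = x ^ a := by
  by_cases ha : a = 0
  · rw [ha, reduceExp_zero]
  · obtain ⟨c, hc⟩ := exists_eq_reduceExp_add (Fintype.card F) a
    conv_rhs => rw [hc]
    rw [pow_add_card_sub_one_mul x (mt reduceExp_eq_zero.mp ha)]

/-- Every monomial of positive degree agrees, as a function, with a reduced one of the same
degree. -/
theorem exists_mem_reducedExps_eval_eq {n k : ℕ} (hk : k ≠ 0) (a : Fin (n + 1) →₀ ℕ)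
    (ha : ∑ j, a j = k) : ∃ b ∈ reducedExps (Fintype.card F) n k,
      ∀ v : Fin (n + 1) → F, eval v (monomial b 1) = eval v (monomial a 1) := by
  set q := Fintype.card F with hq
  have hq2 : 2 ≤ q := Fintype.one_lt_card
  have hex : ∃ i, a i ≠ 0 := by
    by_contra! h
    exact hk (by simp [← ha, h])
  obtain ⟨i, hi, hmin⟩ : ∃ i, a i ≠ 0 ∧ ∀ j < i, a j = 0 := by
    obtain ⟨i, hi, hmin⟩ := WellFounded.has_min (wellFounded_lt (α := Fin (n + 1)))
      {i | a i ≠ 0} hex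
    exact ⟨i, hi, fun j hj => by_contra fun h => hmin j h hj⟩
  choose c hc using fun j => exists_eq_reduceExp_add q (a j)
  refine ⟨a.mapRange (reduceExp q) (reduceExp_zero q) + Finsupp.single i ((q - 1) * ∑ j, c j),
    mem_reducedExps.mpr ⟨i, ?_, ?_, ?_, ?_⟩, fun v => ?_⟩
  · rw [← ha, sum_congr rfl fun j _ => hc j]
    simp [sum_add_distrib, mul_sum, Finsupp.single_apply]
  · intro j hj
    simp [hmin j hj, reduceExp_zero, hj.ne]
  · simp [reduceExp_eq_zero, hi]
  · intro j hj
    simpa [hj.ne'] using reduceExp_lt hq2 (a j)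
  · rw [eval_monomial_one, eval_monomial_one]
    refine prod_congr rfl fun j _ => ?_
    by_cases hj : j = i
    · subst hj
      simp only [Finsupp.add_apply, Finsupp.mapRange_apply, Finsupp.single_eq_same]
      rw [hq, pow_add_card_sub_one_mul _ (mt reduceExp_eq_zero.mp hi), pow_reduceExp]
    · simp [hj, hq, pow_reduceExp]

theorem exists_smul_isStdRep {K : Type*} [Field K] {n : ℕ} {v : Fin (n + 1) → K} (hv : v ≠ 0) :
    ∃ (c : K) (w : Fin (n + 1) → K), IsStdRep w ∧ v = c • w := by
  obtain ⟨i, hi, hmin⟩ := WellFounded.has_min (wellFounded_lt (α := Fin (n + 1)))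
    {i | v i ≠ 0} (Function.ne_iff.mp hv)
  refine ⟨v i, (v i)⁻¹ • v, ⟨i, fun j hj => ?_, inv_mul_cancel₀ hi⟩, ?_⟩
  · have : v j = 0 := by_contra fun h => hmin j h hj
    simp [this]
  · rw [smul_inv_smul₀ hi]

/-- The monomials with reduced exponents are linearly independent as functions on the points. -/
theorem linearIndependent_evalOnPts_monomial {n k : ℕ} (hk : k ≠ 0) :
    LinearIndependent F fun a : reducedExps (Fintype.card F) n k =>
      evalOnPts F n (monomial a.1 1) := by
  set q := Fintype.card F with hq
  have hq2 : 2 ≤ q := Fintype.one_lt_card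
  rw [Fintype.linearIndependent_iff]
  intro c hc
  have hdeg (a : reducedExps q n k) : ∑ j, a.1 j = k := by
    obtain ⟨_, h, _⟩ := mem_reducedExps.mp a.2
    exact h
  have hall (v : Fin (n + 1) → F) : ∑ a, c a * ∏ j, v j ^ a.1 j = 0 := by
    by_cases hv : v = 0
    · refine sum_eq_zero fun a _ => ?_
      simp [hv, prod_pow_eq_pow_sum, hdeg, hk]
    · obtain ⟨t, w, hw, rfl⟩ := exists_smul_isStdRep hv
      have h := congrFun hc ⟨w, hw⟩
      simp only [evalOnPts, LinearMap.coe_mk, AddHom.coe_mk, Finset.sum_apply, Pi.smul_apply,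
        smul_eq_mul, eval_monomial_one, Pi.zero_apply] at h
      simp only [Pi.smul_apply, smul_eq_mul, mul_pow, prod_mul_distrib, prod_pow_eq_pow_sum, hdeg]
      rw [← mul_zero (t ^ k), ← h, mul_sum]
      exact sum_congr rfl fun a _ => by ring
  let red (a : reducedExps q n k) := a.1.mapRange (reduceExp q) (reduceExp_zero q)
  have hinj : Function.Injective red := fun a b h =>
    Subtype.ext (injOn_mapRange_reduceExp q n k a.2 b.2 h)
  have hp : ∑ a, monomial (red a) (c a) = 0 := by
    refine eq_zero_of_eval_zero_at_prod_finset _ (fun _ => univ) (fun j => ?_) fun v _ => ?_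
    · rw [card_univ, degreeOf_lt_iff (by omega)]
      intro s hs
      obtain ⟨a, _, ha⟩ := mem_biUnion.mp (support_sum hs)
      rw [mem_singleton.mp (support_monomial_subset ha)]
      exact reduceExp_lt hq2 (a.1 j)
    · rw [map_sum, ← hall v]
      refine sum_congr rfl fun a _ => ?_
      rw [eval_monomial, Finsupp.prod_fintype _ _ fun _ => pow_zero _]
      simp [red, hq, pow_reduceExp]
  intro a
  have h := congrArg (coeff (red a)) hp
  simpa [coeff_sum, coeff_monomial, hinj.eq_iff] using h

theorem PRM_eq_span {n k : ℕ} (hk : k ≠ 0) :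
    PRM F n k = Submodule.span F (Set.range fun a : reducedExps (Fintype.card F) n k =>
      evalOnPts F n (monomial a.1 1)) := by
  apply le_antisymm
  · rintro _ ⟨p, hp, rfl⟩
    rw [p.as_sum, map_sum]
    refine Submodule.sum_mem _ fun a ha => ?_
    have hdeg : ∑ j, a j = k := by
      rw [← Finsupp.degree_eq_sum, Finsupp.degree_eq_weight_one]
      exact hp (mem_support_iff.mp ha)
    obtain ⟨b, hb, hba⟩ := exists_mem_reducedExps_eval_eq (F := F) hk a hdeg
    have h : evalOnPts F n (monomial a (coeff a p)) =
        coeff a p • evalOnPts F n (monomial b 1) := by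
      rw [← map_smul]
      ext v
      simp only [evalOnPts, LinearMap.coe_mk, AddHom.coe_mk, smul_eval, hba v]
      rw [← smul_eval, smul_monomial, smul_eq_mul, mul_one]
    rw [h]
    exact Submodule.smul_mem _ _ (Submodule.subset_span ⟨⟨b, hb⟩, rfl⟩)
  · rw [Submodule.span_le]
    rintro _ ⟨a, rfl⟩
    refine Submodule.mem_map_of_mem (isHomogeneous_monomial _ ?_)
    obtain ⟨_, h, _⟩ := mem_reducedExps.mp a.2
    rwa [Finsupp.degree_eq_sum]

theorem finrank_PRM {n k : ℕ} (hk : k ≠ 0) :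
    Module.finrank F (PRM F n k) = (reducedExps (Fintype.card F) n k).card := by
  rw [PRM_eq_span hk, finrank_span_eq_card (linearIndependent_evalOnPts_monomial hk),
    Fintype.card_coe]

end Evaluation

theorem stmt2 (q n : ℕ) (F : Type*) [Field F] [Fintype F] [DecidableEq F]
    (hq : Fintype.card F = q) (hn : 1 ≤ n) (k : ℕ) (hk1 : 1 ≤ k) (hk2 : k ≤ n * (q - 1)) :
    (Module.finrank F (PRM F n k) : ℤ) =
      ((n + k).choose k : ℤ) -
        ∑ j ∈ Finset.Icc 2 (n + 1), (-1) ^ j * ((n + 1).choose j : ℤ) *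
          ∑ i ∈ Finset.range (j - 1),
            intBinom ((k : ℤ) + (i + 1) * ((q : ℤ) - 1) - j * q + n)
              ((k : ℤ) + (i + 1) * ((q : ℤ) - 1) - j * q) := by
  have hq2 : 1 < q := hq ▸ Fintype.one_lt_card
  obtain ⟨r, rfl⟩ : ∃ r, q = r + 1 := ⟨q - 1, by omega⟩
  have hk : k ≠ 0 := by omega
  have key := congrArg (PowerSeries.coeff (R := ℤ) k)
    (PowerSeries.sum_geom_pow_eq r n (by omega))
  rw [map_add, map_sub, map_sum, map_sum, PowerSeries.coeff_one, if_neg hk, zero_add] at key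
  rw [finrank_PRM hk, hq, card_reducedExps, key]
  congr 1
  · rw [PowerSeries.mk_one_pow_eq_mk_choose_add, PowerSeries.coeff_mk, Nat.choose_symm_add]
  · refine Finset.sum_congr rfl fun j _ => ?_
    have hc : ((-1) ^ j * ((n + 1).choose j : PowerSeries ℤ)) =
        PowerSeries.C ((-1) ^ j * ((n + 1).choose j : ℤ)) := by simp
    rw [hc, PowerSeries.coeff_C_mul, map_sum]
    congr 1
    refine Finset.sum_congr rfl fun i hi => ?_
    rw [Finset.mem_range] at hi
    apply PowerSeries.coeff_mk_one_pow_mul_X_pow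
    obtain ⟨l, rfl⟩ : ∃ l, j = i + 1 + l := ⟨j - 1 - i, by omega⟩
    have : i + 1 + l - 1 - i = l := by omega
    rw [this]
    push_cast
    ring
end

section
/- Suppose n(q-1) − (q-1)/2 < k ≤ n(q-1), and let ℓ = n(q-1) − k. Then dim(Hull(C_{n,k}^q)) = dim(C_{n,ℓ}^q) − 1 = C(n+ℓ, ℓ) − 1. -/
open scoped BigOperators

section Representatives

variable {F : Type*} [Field F] {n : ℕ}

theorem IsStdRep.eq_one_of_smul {x p : Fin (n + 1) → F} {c : F} (hx : IsStdRep x)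
    (hp : IsStdRep p) (h : x = c • p) : c = 1 := by
  obtain ⟨i, hi, hi1⟩ := hp
  obtain ⟨j, hj, hj1⟩ := hx
  have hval : ∀ k, x k = c * p k := fun k => by rw [h]; rfl
  rcases lt_trichotomy i j with hij | hij | hij
  · have hc : c = 0 := by simpa [hi1, hj i hij] using (hval i).symm
    have := hval j
    simp [hc, hj1] at this
  · subst hij
    simpa [hi1, hj1] using (hval i).symm
  · have := hval j
    simp [hi j hij, hj1] at this

theorem IsStdRep.eq_smul_iff {x p : Fin (n + 1) → F} (hx : IsStdRep x) (hp : IsStdRep p) (c : F) :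
    x = c • p ↔ c = 1 ∧ x = p := by
  constructor
  · intro h
    have hc := hx.eq_one_of_smul hp h
    exact ⟨hc, by rw [h, hc, one_smul]⟩
  · rintro ⟨rfl, h⟩
    rw [h, one_smul]

theorem IsStdRep.ne_zero {p : Fin (n + 1) → F} (hp : IsStdRep p) : p ≠ 0 := by
  rintro rfl
  obtain ⟨i, -, hi⟩ := hp
  simp at hi

theorem exists_smul_stdRep {v : Fin (n + 1) → F} (hv : v ≠ 0) :
    ∃ (u : Fˣ) (p : ProjPts F n), (u : F) • p.1 = v := by
  obtain ⟨i, hi, hmin⟩ := wellFounded_lt.has_min {i | v i ≠ 0} (Function.ne_iff.mp hv)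
  have hi' : v i ≠ 0 := hi
  refine ⟨Units.mk0 (v i) hi', ⟨(v i)⁻¹ • v, i, fun j hj => ?_, ?_⟩, ?_⟩
  · have : v j = 0 := by
      by_contra h
      exact hmin j h hj
    simp [this]
  · simp [hi']
  · simp [smul_smul, hi']

/-- The last coordinate vector, as a standard representative. -/
def lastPt (F : Type*) [Field F] (n : ℕ) : ProjPts F n :=
  ⟨Pi.single (Fin.last n) 1, Fin.last n, fun _ hj => Pi.single_eq_of_ne hj.ne 1, by simp⟩

theorem IsStdRep.snoc {p : Fin (n + 1) → F} (hp : IsStdRep p) (t : F) :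
    IsStdRep (Fin.snoc p t : Fin (n + 1 + 1) → F) := by
  obtain ⟨i, hi, hi1⟩ := hp
  refine ⟨i.castSucc, fun j hj => ?_, by simpa using hi1⟩
  induction j using Fin.lastCases with
  | last => exact absurd hj (not_lt.mpr (Fin.le_last _))
  | cast j => simpa using hi j (by simpa using hj)

theorem isStdRep_snoc_cases {p : Fin (n + 1) → F} {t : F}
    (h : IsStdRep (Fin.snoc p t : Fin (n + 1 + 1) → F)) :
    IsStdRep p ∨ (p = 0 ∧ t = 1) := by
  obtain ⟨i, hi, hi1⟩ := h
  induction i using Fin.lastCases with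
  | last =>
    right
    refine ⟨funext fun j => ?_, by simpa using hi1⟩
    simpa using hi j.castSucc (Fin.castSucc_lt_last j)
  | cast i =>
    left
    refine ⟨i, fun j hj => ?_, by simpa using hi1⟩
    simpa using hi j.castSucc (by simpa using hj)

variable [Fintype F]

theorem sum_units_smul_projPts [DecidableEq F] {M : Type*} [AddCommMonoid M]
    (g : (Fin (n + 1) → F) → M) :
    ∑ v, g v = g 0 + ∑ u : Fˣ, ∑ p : ProjPts F n, g ((u : F) • p.1) := by
  rw [← Fintype.sum_prod_type' (f := fun (u : Fˣ) (p : ProjPts F n) => g ((u : F) • p.1)),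
    ← Finset.add_sum_erase _ _ (Finset.mem_univ (0 : Fin (n + 1) → F))]
  congr 1
  symm
  refine Finset.sum_bij (fun a _ => (a.1 : F) • a.2.1) ?_ ?_ ?_ ?_
  · rintro ⟨u, p⟩ -
    simp [p.2.ne_zero]
  · rintro ⟨u, p⟩ - ⟨w, r⟩ - h
    simp only at h
    have h1 : p.1 = ((u⁻¹ * w : Fˣ) : F) • r.1 := by
      rw [Units.val_mul, mul_smul, ← h, smul_smul]
      simp
    have h2 := p.2.eq_one_of_smul r.2 h1
    rw [h2, one_smul] at h1
    have h3 : u⁻¹ * w = 1 := Units.ext h2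
    exact Prod.ext (inv_mul_eq_one.mp h3) (Subtype.ext h1)
  · intro v hv
    obtain ⟨u, p, h⟩ := exists_smul_stdRep (Finset.ne_of_mem_erase hv)
    exact ⟨(u, p), Finset.mem_univ _, h⟩
  · intros
    rfl

theorem sum_projPts_succ {M : Type*} [AddCommMonoid M] (g : (Fin (n + 1 + 1) → F) → M) :
    ∑ p : ProjPts F (n + 1), g p.1 =
      g (lastPt F (n + 1)).1 + ∑ p : ProjPts F n, ∑ t : F, g (Fin.snoc p.1 t) := by
  rw [← Fintype.sum_prod_type' (f := fun (p : ProjPts F n) (t : F) => g (Fin.snoc p.1 t))]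
  refine Eq.trans ?_ (Fintype.sum_option (fun o : Option (ProjPts F n × F) =>
      g (o.elim (lastPt F (n + 1)).1 fun a => Fin.snoc a.1.1 a.2)))
  symm
  have hlast : (lastPt F (n + 1)).1 = Fin.snoc (0 : Fin (n + 1) → F) 1 := by
    funext j
    induction j using Fin.lastCases with
    | last => simp [lastPt]
    | cast j => simp [lastPt]
  refine Fintype.sum_bijective (fun o : Option (ProjPts F n × F) =>
      (o.elim (lastPt F (n + 1)) fun a => ⟨Fin.snoc a.1.1 a.2, a.1.2.snoc a.2⟩ :
        ProjPts F (n + 1))) ⟨?_, ?_⟩ _ _ ?_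
  · rintro (_ | ⟨p, t⟩) (_ | ⟨r, s⟩) h
    · rfl
    · have h' := congrArg Subtype.val h
      simp only [Option.elim, hlast] at h'
      exact absurd (Fin.snoc_injective2 h').1.symm r.2.ne_zero
    · have h' := congrArg Subtype.val h
      simp only [Option.elim, hlast] at h'
      exact absurd (Fin.snoc_injective2 h').1 p.2.ne_zero
    · have h' := congrArg Subtype.val h
      simp only [Option.elim] at h'
      obtain ⟨h1, h2⟩ := Fin.snoc_injective2 h'
      exact congrArg some (Prod.ext (Subtype.ext h1) h2)
  · rintro ⟨v, hv⟩
    rw [← Fin.snoc_init_self v] at hv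
    rcases isStdRep_snoc_cases hv with h | ⟨h0, h1⟩
    · exact ⟨some (⟨_, h⟩, v (Fin.last _)), Subtype.ext (Fin.snoc_init_self v)⟩
    · refine ⟨none, Subtype.ext ?_⟩
      simp only [Option.elim, hlast]
      rw [← Fin.snoc_init_self v, h0, h1]
  · rintro (_ | ⟨p, t⟩) <;> rfl

end Representatives

section Polynomials

open MvPolynomial

theorem MvPolynomial.IsHomogeneous.eval_smul {σ R : Type*} [CommSemiring R] [Fintype σ]
    {f : MvPolynomial σ R} {d : ℕ} (hf : f.IsHomogeneous d) (c : R) (v : σ → R) :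
    eval (c • v) f = c ^ d * eval v f := by
  rw [eval_eq', eval_eq', Finset.mul_sum]
  refine Finset.sum_congr rfl fun a ha => ?_
  have hdeg : ∑ i, a i = d := by
    rw [hf.degree_eq_sum_deg_support ha, ← Finsupp.degree_eq_sum]
    rfl
  simp only [Pi.smul_apply, smul_eq_mul, mul_pow, Finset.prod_mul_distrib,
    Finset.prod_pow_eq_pow_sum, hdeg]
  ring

theorem finrank_homogeneousSubmodule_fin (F : Type*) [Field F] (n d : ℕ) :
    Module.finrank F (homogeneousSubmodule (Fin (n + 1)) F d) = (n + d).choose d := by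
  classical
  rw [homogeneousSubmodule_eq_finsupp_supported,
    (AddMonoidAlgebra.supportedEquivFinsupp
      (R := F) {a : Fin (n + 1) →₀ ℕ | a.degree = d}).finrank_eq]
  have hset : {a : Fin (n + 1) →₀ ℕ | a.degree = d} =
      ((Finset.univ : Finset (Fin (n + 1))).finsuppAntidiag d : Set (Fin (n + 1) →₀ ℕ)) := by
    ext a
    simp [Finsupp.degree_eq_sum]
  rw [hset, Module.finrank_finsupp_self]
  simp only [Finset.coe_sort_coe, Fintype.card_coe, Finset.card_finsuppAntidiag_nat_eq_choose]
  simp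

variable {F : Type*} [Field F] [Fintype F] {n : ℕ}

theorem sum_projPts_eval_of_lt [NeZero n] {f : MvPolynomial (Fin (n + 1)) F} {d : ℕ}
    (hf : f.IsHomogeneous d) (hd : d < Fintype.card F - 1) :
    ∑ p : ProjPts F n, eval p.1 f = eval (lastPt F n).1 f := by
  obtain ⟨m, rfl⟩ := Nat.exists_eq_succ_of_ne_zero (NeZero.ne n)
  rw [sum_projPts_succ (fun v => eval v f), add_eq_left]
  refine Finset.sum_eq_zero fun p _ => ?_
  simp only [eval_eq']
  rw [Finset.sum_comm]
  refine Finset.sum_eq_zero fun a ha => ?_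
  have hdeg : a (Fin.last _) < Fintype.card F - 1 := by
    refine lt_of_le_of_lt ?_ hd
    rw [hf.degree_eq_sum_deg_support ha]
    exact Finsupp.le_degree _ _
  simp only [Fin.prod_univ_castSucc (n := m + 1), Fin.snoc_castSucc, Fin.snoc_last,
    ← Finset.mul_sum, FiniteField.sum_pow_lt_card_sub_one _ _ hdeg, mul_zero]

theorem sum_projPts_eval_eq_zero {f : MvPolynomial (Fin (n + 1)) F}
    (hn : n ≠ 0) (hf : f.IsHomogeneous (n * (Fintype.card F - 1))) :
    ∑ p : ProjPts F n, eval p.1 f = 0 := by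
  classical
  have hq : 0 < Fintype.card F - 1 := Nat.sub_pos_of_lt Fintype.one_lt_card
  have hd : n * (Fintype.card F - 1) ≠ 0 := (Nat.mul_pos (Nat.pos_of_ne_zero hn) hq).ne'
  have hsum := f.sum_eval_eq_zero (lt_of_le_of_lt hf.totalDegree_le (by
    rw [Fintype.card_fin, mul_comm]
    exact Nat.mul_lt_mul_of_pos_left (Nat.lt_succ_self n) hq))
  have h0 : eval (0 : Fin (n + 1) → F) f = 0 := by
    simpa [hd] using hf.eval_smul 0 0
  rw [sum_units_smul_projPts, h0, zero_add] at hsum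
  have hu : ∀ u : Fˣ, (u : F) ^ (n * (Fintype.card F - 1)) = 1 := fun u => by
    rw [mul_comm, pow_mul, FiniteField.pow_card_sub_one_eq_one _ u.ne_zero, one_pow]
  simpa [hf.eval_smul, hu, Fintype.card_units, Nat.cast_sub Fintype.card_pos,
    FiniteField.cast_card_eq_zero] using hsum

end Polynomials

section PointKernel

open MvPolynomial

variable {F : Type*} [Field F] [Fintype F] {n : ℕ}

/-- The sign of a term in the expansion of `1 - ∑ j, x ^ j * y ^ (q - 1 - j)`. -/
def termSign (F : Type*) [Field F] {q : ℕ} (o : Option (Fin q)) : F :=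
  o.elim 1 fun _ => -1

/-- The exponent of `x` in a term of `1 - ∑ j, x ^ j * y ^ (q - 1 - j)`. -/
def leftExp {q : ℕ} (o : Option (Fin q)) : ℕ :=
  o.elim 0 fun j => j

/-- The exponent of `y` in a term of `1 - ∑ j, x ^ j * y ^ (q - 1 - j)`. -/
def rightExp {q : ℕ} (o : Option (Fin q)) : ℕ :=
  o.elim 0 fun j => q - 1 - j

theorem sum_termSign_mul_pow [DecidableEq F] (x y : F) :
    ∑ o : Option (Fin (Fintype.card F)), termSign F o * x ^ leftExp o * y ^ rightExp o =
      if x = y then 1 else 0 := by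
  have hgeom := Commute.mul_geom_sum₂ (Commute.all x y) (Fintype.card F)
  rw [FiniteField.pow_card, FiniteField.pow_card, Finset.sum_range] at hgeom
  simp only [Fintype.sum_option, termSign, leftExp, rightExp, Option.elim, pow_zero, mul_one,
    neg_mul, one_mul, Finset.sum_neg_distrib]
  split_ifs with h
  · subst h
    have hpow : ∀ j : Fin (Fintype.card F),
        x ^ (j : ℕ) * x ^ (Fintype.card F - 1 - (j : ℕ)) = x ^ (Fintype.card F - 1) := fun j => by
      rw [← pow_add]
      congr 1
      omega
    simp [hpow]
  · have h1 := mul_left_cancel₀ (sub_ne_zero.mpr h) (hgeom.trans (mul_one _).symm)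
    rw [h1, add_neg_cancel]

theorem exists_leftExp_add_rightExp {q : ℕ} {ι : Type*} [Fintype ι] (u : ι → Option (Fin q)) :
    ∃ m ≤ Fintype.card ι, ∑ i, leftExp (u i) + ∑ i, rightExp (u i) = m * (q - 1) := by
  refine ⟨∑ i, (u i).elim 0 fun _ => 1, ?_, ?_⟩
  · refine (Finset.sum_le_card_nsmul _ _ 1 fun i _ => ?_).trans (by simp)
    cases u i <;> simp
  · rw [← Finset.sum_add_distrib, Finset.sum_mul]
    refine Finset.sum_congr rfl fun i _ => ?_
    cases u i with
    | none => simp [leftExp, rightExp]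
    | some j =>
      simp only [leftExp, rightExp, Option.elim]
      omega

theorem sum_pow_ne_zero_imp {m : ℕ} (h : ∑ x : F, x ^ m ≠ 0) :
    m ≠ 0 ∧ Fintype.card F - 1 ∣ m := by
  classical
  have hm : m ≠ 0 := by
    rintro rfl
    simp at h
  refine ⟨hm, ?_⟩
  by_contra hdvd
  apply h
  have h0 := FiniteField.sum_pow_units F m
  rw [if_neg hdvd] at h0
  have h1 : ∀ x : {x : F // ¬ x ≠ 0}, (x : F) ^ m = 0 := fun x => by
    rw [not_not.mp x.2, zero_pow hm]
  have hunits := (unitsEquivNeZero (G₀ := F)).sum_comp fun x => (x : F) ^ m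
  rw [← Fintype.sum_subtype_add_sum_subtype (fun x : F => x ≠ 0), ← hunits]
  simp only [h1, Finset.sum_const_zero, add_zero]
  exact h0

theorem prod_pow_mem_PRM {d : ℕ} (a : Fin (n + 1) → ℕ) (ha : ∑ i, a i = d) :
    (fun p : ProjPts F n => ∏ i, p.1 i ^ a i) ∈ PRM F n d := by
  refine ⟨∏ i, X i ^ a i, ?_, ?_⟩
  · rw [← ha]
    exact IsHomogeneous.prod _ _ _ fun i _ => isHomogeneous_X_pow i (a i)
  · funext p
    simp [evalOnPts]

theorem prod_pow_mem_PRM_of_pos {d s : ℕ} (a : Fin (n + 1) → ℕ) (h0 : ∑ i, a i ≠ 0)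
    (ha : ∑ i, a i + s * (Fintype.card F - 1) = d) :
    (fun p : ProjPts F n => ∏ i, p.1 i ^ a i) ∈ PRM F n d := by
  obtain ⟨i, -, hi⟩ := Finset.exists_ne_zero_of_sum_ne_zero h0
  have hred : ∀ x : F, x ^ (a i + s * (Fintype.card F - 1)) = x ^ a i := fun x => by
    rcases eq_or_ne x 0 with rfl | hx
    · rw [zero_pow hi, zero_pow (by omega)]
    · rw [pow_add, mul_comm s, pow_mul, FiniteField.pow_card_sub_one_eq_one _ hx, one_pow, mul_one]
  convert prod_pow_mem_PRM (F := F) (d := d)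
    (fun j => a j + if j = i then s * (Fintype.card F - 1) else 0) (by
      simpa [Finset.sum_add_distrib] using ha) using 3 with p j
  split_ifs with h
  · subst h
    rw [hred]
  · simp

theorem sum_prod_termSign_mul_pow [DecidableEq F] (l : ℕ) (p x : ProjPts F n) :
    ∑ u : Fin (n + 1) → Option (Fin (Fintype.card F)),
      ((∑ c : F, c ^ (l + ∑ i, rightExp (u i))) * ∏ i, p.1 i ^ rightExp (u i)) *
        ((∏ i, termSign F (u i)) * ∏ i, x.1 i ^ leftExp (u i)) = if x = p then 1 else 0 := by
  have hprod : ∀ c : F,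
      ∑ u : Fin (n + 1) → Option (Fin (Fintype.card F)), c ^ l *
        ∏ i, (termSign F (u i) * x.1 i ^ leftExp (u i) * (c * p.1 i) ^ rightExp (u i)) =
      if c = 1 then if x = p then 1 else 0 else 0 := fun c => by
    rw [← Finset.mul_sum, ← Fintype.prod_sum (fun i o =>
      termSign F o * x.1 i ^ leftExp o * (c * p.1 i) ^ rightExp o)]
    simp only [sum_termSign_mul_pow, Fintype.prod_ite_zero, Finset.prod_const_one]
    have hiff : (∀ i, x.1 i = c * p.1 i) ↔ c = 1 ∧ x = p := by
      rw [Subtype.ext_iff, ← x.2.eq_smul_iff p.2, funext_iff]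
      rfl
    simp only [hiff, ite_and]
    split_ifs with h1 <;> simp [h1]
  have hsum := Finset.sum_congr rfl fun c (_ : c ∈ (Finset.univ : Finset F)) => hprod c
  rw [Finset.sum_comm, Finset.sum_ite_eq' Finset.univ (1 : F),
    if_pos (Finset.mem_univ _)] at hsum
  rw [← hsum]
  refine Finset.sum_congr rfl fun u _ => ?_
  rw [Finset.sum_mul, Finset.sum_mul]
  refine Finset.sum_congr rfl fun c _ => ?_
  simp only [Finset.prod_mul_distrib, mul_pow, pow_add, Finset.prod_pow_eq_pow_sum]
  ring

theorem exists_delta_decomposition [DecidableEq F] {k l : ℕ} (hl : l < Fintype.card F - 1)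
    (hkl : k + l = n * (Fintype.card F - 1)) :
    ∃ (ι : Type) (_ : Fintype ι) (a b : ι → ProjPts F n → F),
      (∀ u, a u ∈ PRM F n k ∨ b u ∈ PRM F n l) ∧
      ∀ p x, ∑ u, a u p * b u x = if x = p then 1 else 0 := by
  refine ⟨Fin (n + 1) → Option (Fin (Fintype.card F)), inferInstance,
    fun u => (∑ c : F, c ^ (l + ∑ i, rightExp (u i))) • fun p => ∏ i, p.1 i ^ rightExp (u i),
    fun u => (∏ i, termSign F (u i)) • fun x => ∏ i, x.1 i ^ leftExp (u i), fun u => ?_,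
    fun p x => by simpa using sum_prod_termSign_mul_pow l p x⟩
  by_cases h0 : ∑ c : F, c ^ (l + ∑ i, rightExp (u i)) = 0
  · left
    simp only [h0, zero_smul]
    exact Submodule.zero_mem _
  obtain ⟨hne, t, ht⟩ := sum_pow_ne_zero_imp h0
  obtain ⟨m, hm, hdeg⟩ := exists_leftExp_add_rightExp u
  rw [Fintype.card_fin] at hm
  rw [mul_comm] at ht
  generalize hQ : Fintype.card F - 1 = Q at *
  have htm : t < m + 1 := by
    by_contra hlt
    have := Nat.mul_le_mul_right Q (not_lt.mp hlt)
    rw [add_mul] at this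
    omega
  rcases (Nat.lt_succ_iff.mp htm).eq_or_lt with rfl | hlt
  · right
    exact Submodule.smul_mem _ _ (prod_pow_mem_PRM _ (by omega))
  · left
    obtain ⟨s, rfl⟩ := Nat.exists_eq_add_of_le (show t ≤ n by omega)
    refine Submodule.smul_mem _ _ (prod_pow_mem_PRM_of_pos (s := s) _ ?_ ?_)
    · intro hz
      rw [hz, add_zero] at ht hne
      have : t ≠ 0 := by
        rintro rfl
        omega
      have := Nat.le_mul_of_pos_left Q (Nat.pos_of_ne_zero this)
      omega
    · rw [hQ]
      rw [add_mul] at hkl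
      omega

end PointKernel

section Hull

open MvPolynomial

variable {F : Type*} [Field F] [Fintype F] {n : ℕ}

theorem sum_mul_eq_zero_of_mem_PRM {k l : ℕ} (hn : n ≠ 0)
    (hkl : k + l = n * (Fintype.card F - 1)) {f g : ProjPts F n → F}
    (hf : f ∈ PRM F n k) (hg : g ∈ PRM F n l) : ∑ p, f p * g p = 0 := by
  obtain ⟨f, hf, rfl⟩ := hf
  obtain ⟨g, hg, rfl⟩ := hg
  have h : (f * g).IsHomogeneous (n * (Fintype.card F - 1)) := hkl ▸ IsHomogeneous.mul hf hg
  simpa [evalOnPts] using sum_projPts_eval_eq_zero hn h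

theorem sum_mul_eq_lastPt_of_mem_PRM [NeZero n] {l : ℕ} (hl : 2 * l < Fintype.card F - 1)
    {f g : ProjPts F n → F} (hf : f ∈ PRM F n l) (hg : g ∈ PRM F n l) :
    ∑ p, f p * g p = f (lastPt F n) * g (lastPt F n) := by
  obtain ⟨f, hf, rfl⟩ := hf
  obtain ⟨g, hg, rfl⟩ := hg
  simpa [evalOnPts] using
    sum_projPts_eval_of_lt (n := n) (IsHomogeneous.mul hf hg) (by omega)

theorem dualCode_PRM {k l : ℕ} (hn : n ≠ 0) (hl : l < Fintype.card F - 1)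
    (hkl : k + l = n * (Fintype.card F - 1)) : dualCode (PRM F n k) = PRM F n l := by
  classical
  refine le_antisymm (fun y hy => ?_) fun y hy c hc =>
    sum_mul_eq_zero_of_mem_PRM hn (by omega) hy hc
  obtain ⟨ι, _, a, b, hab, hδ⟩ := exists_delta_decomposition hl hkl
  have hy_sum : y = ∑ u, (∑ p, y p * a u p) • b u := by
    funext x
    simp only [Finset.sum_apply, Pi.smul_apply, smul_eq_mul, Finset.sum_mul]
    rw [Finset.sum_comm]
    simp [mul_assoc, ← Finset.mul_sum, hδ]
  rw [hy_sum]
  refine Submodule.sum_mem _ fun u _ => ?_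
  rcases hab u with h | h
  · rw [hy _ h, zero_smul]
    exact Submodule.zero_mem _
  · exact Submodule.smul_mem _ _ h

theorem dualCode_PRM_complement {k l : ℕ} (hn : n ≠ 0) (hl : l < Fintype.card F - 1)
    (hkl : k + l = n * (Fintype.card F - 1)) : dualCode (PRM F n l) = PRM F n k := by
  classical
  refine le_antisymm (fun y hy => ?_) fun y hy c hc =>
    sum_mul_eq_zero_of_mem_PRM hn hkl hy hc
  obtain ⟨ι, _, a, b, hab, hδ⟩ := exists_delta_decomposition hl hkl
  have hy_sum : y = ∑ u, (∑ x, y x * b u x) • a u := by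
    funext p
    simp only [Finset.sum_apply, Pi.smul_apply, smul_eq_mul, Finset.sum_mul]
    rw [Finset.sum_comm]
    simp [mul_assoc, mul_comm (b _ _), ← Finset.mul_sum, hδ]
  rw [hy_sum]
  refine Submodule.sum_mem _ fun u _ => ?_
  rcases hab u with h | h
  · exact Submodule.smul_mem _ _ h
  · rw [hy _ h, zero_smul]
    exact Submodule.zero_mem _

theorem finrank_PRM_of_lt {l : ℕ} (hl : l < Fintype.card F) :
    Module.finrank F (PRM F n l) = (n + l).choose l := by
  rw [← finrank_homogeneousSubmodule_fin F n l]
  have hinj : Function.Injective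
      ((evalOnPts F n).domRestrict (homogeneousSubmodule (Fin (n + 1)) F l)) := by
    rw [← LinearMap.ker_eq_bot, LinearMap.ker_eq_bot']
    rintro ⟨f, hf⟩ h0
    have hvan : ∀ p : ProjPts F n, eval p.1 f = 0 := fun p => congrFun h0 p
    refine Subtype.ext (IsHomogeneous.eq_zero_of_forall_eval_eq_zero_of_le_card hf (fun v => ?_) ?_)
    · rcases eq_or_ne v 0 with rfl | hv
      · rw [← zero_smul F (lastPt F n).1, IsHomogeneous.eval_smul hf, hvan, mul_zero]
      · obtain ⟨u, p, rfl⟩ := exists_smul_stdRep hv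
        rw [IsHomogeneous.eval_smul hf, hvan, mul_zero]
    · rw [Cardinal.mk_fintype]
      exact_mod_cast hl.le
  rw [← LinearMap.finrank_range_of_inj hinj, LinearMap.range_domRestrict]
  rfl

theorem finrank_hull_add_one [NeZero n] {k l : ℕ} (hl : 2 * l < Fintype.card F - 1)
    (hkl : k + l = n * (Fintype.card F - 1)) :
    Module.finrank F ↥(PRM F n k ⊓ dualCode (PRM F n k)) + 1 = Module.finrank F (PRM F n l) := by
  have hn := NeZero.ne n
  have hl' : l < Fintype.card F - 1 := by omega
  let φ : PRM F n l →ₗ[F] F := (LinearMap.proj (lastPt F n)).comp (PRM F n l).subtype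
  let e : ProjPts F n → F := evalOnPts F n (X (Fin.last n) ^ l)
  have he : e ∈ PRM F n l := ⟨_, isHomogeneous_X_pow _ _, rfl⟩
  have he1 : e (lastPt F n) = 1 := by simp [e, evalOnPts, lastPt]
  have hker : (LinearMap.ker φ).map (PRM F n l).subtype = PRM F n k ⊓ dualCode (PRM F n k) := by
    rw [dualCode_PRM hn hl' hkl, ← dualCode_PRM_complement hn hl' hkl]
    ext f
    simp only [Submodule.mem_map, LinearMap.mem_ker, Submodule.mem_inf]
    constructor
    · rintro ⟨⟨f, hf⟩, h0, rfl⟩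
      have h0' : f (lastPt F n) = 0 := h0
      refine ⟨fun c hc => ?_, hf⟩
      exact (sum_mul_eq_lastPt_of_mem_PRM hl hf hc).trans (by rw [h0', zero_mul])
    · rintro ⟨hdual, hf⟩
      refine ⟨⟨f, hf⟩, ?_, rfl⟩
      have := (sum_mul_eq_lastPt_of_mem_PRM hl hf he).symm.trans (hdual e he)
      rwa [he1, mul_one] at this
  have hsurj : LinearMap.range φ = ⊤ := LinearMap.range_eq_top.mpr fun c =>
    ⟨c • ⟨e, he⟩, by simp [φ, he1]⟩
  have hrank := LinearMap.finrank_range_add_finrank_ker φ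
  rw [hsurj, finrank_top, Module.finrank_self] at hrank
  rw [← hker, Submodule.finrank_map_subtype_eq, add_comm, hrank]

end Hull

theorem stmt17 (q n : ℕ) (F : Type*) [Field F] [Fintype F] [DecidableEq F]
    (hq : Fintype.card F = q) (hn : 1 ≤ n) (k : ℕ) (hk1 : (2 * n - 1) * (q - 1) < 2 * k)
    (hk2 : k ≤ n * (q - 1)) :
    (Module.finrank F ↥(PRM F n k ⊓ dualCode (PRM F n k)) : ℤ) =
        (Module.finrank F (PRM F n (n * (q - 1) - k)) : ℤ) - 1 ∧
    Module.finrank F (PRM F n (n * (q - 1) - k))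
      = (n + (n * (q - 1) - k)).choose (n * (q - 1) - k) := by
  subst hq
  have : NeZero n := ⟨by omega⟩
  have hl : 2 * (n * (Fintype.card F - 1) - k) < Fintype.card F - 1 := by
    rw [Nat.sub_mul, mul_assoc] at hk1
    have := Nat.le_mul_of_pos_left (Fintype.card F - 1) hn
    omega
  refine ⟨?_, finrank_PRM_of_lt (by omega)⟩
  rw [← finrank_hull_add_one hl (Nat.add_sub_of_le hk2)]
  simp
end
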